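/- Let X be a Banach space, Y a normed space, F : X ⇉ Y a closed set-valued map, (x̄,ȳ) ∈ gph F, (u,v) ∈ X×Y and γ ∈ (0,1]. Then F is directionally metrically γ-regular at (x̄,ȳ) in direction (u,v) if and only if liminf |Γ φ^γ(·,y)|(x) > 0, where the liminf is taken over (x,y) →_{(u,v)} (x̄,ȳ) with φ(x,y) > 0 and φ(x,y)^γ/‖(x,y) − (x̄,ȳ)‖ → 0. -/

import Mathlib

open Filter Metric Set Topology
open scoped ENNReal NNReal Classical

noncomputable section

/-- The conic hull `⋃ λ ≥ 0, λ • B((u,v), ε)` of the open ball of radius `ε` around `(u, v)`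
in `X × Y`, where `X × Y` carries the sum norm `‖(x,y)‖ = ‖x‖ + ‖y‖`. -/
def coneBall2 {X Y : Type*} [NormedAddCommGroup X] [NormedSpace ℝ X]
    [NormedAddCommGroup Y] [NormedSpace ℝ Y] (u : X) (v : Y) (ε : ℝ) : Set (X × Y) :=
  {p | ∃ lam : ℝ, 0 ≤ lam ∧ ∃ w : X, ∃ z : Y, ‖w - u‖ + ‖z - v‖ < ε ∧ p = (lam • w, lam • z)}

/-- `F` is directionally metrically `γ`-regular at `(xbar, ybar)` in direction `(u, v)`
with modulus `τ`: there are `δ, ε, η > 0` such that `d(x, F⁻¹(y)) ≤ τ d(y, F(x))^γ`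
for all `(x,y) ∈ B((xbar,ybar), δ)` with `(x,y) ∈ (xbar,ybar) + cone B((u,v), ε)` and
`d(y,F(x)) ≤ η ‖(x,y)-(xbar,ybar)‖^(1/γ)`.  Distances to sets are extended-real valued
(equal to `+∞` for the empty set). -/
def DirHolderRegular {X Y : Type*} [NormedAddCommGroup X] [NormedSpace ℝ X]
    [NormedAddCommGroup Y] [NormedSpace ℝ Y]
    (F : X → Set Y) (xbar : X) (ybar : Y) (u : X) (v : Y) (γ τ : ℝ) : Prop :=
  ∃ δ > (0:ℝ), ∃ ε > (0:ℝ), ∃ η > (0:ℝ), ∀ x : X, ∀ y : Y,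
    ‖x - xbar‖ + ‖y - ybar‖ < δ →
    (x - xbar, y - ybar) ∈ coneBall2 u v ε →
    EMetric.infEdist y (F x) ≤ ENNReal.ofReal (η * (‖x - xbar‖ + ‖y - ybar‖) ^ (1/γ)) →
    EMetric.infEdist x {x' : X | y ∈ F x'} ≤ ENNReal.ofReal τ * EMetric.infEdist y (F x) ^ γ

/-- The lower semicontinuous envelope `φ(x,y) = liminf_{x' → x} d(y, F(x'))`. -/
def lscEnv {X Y : Type*} [NormedAddCommGroup X] [NormedSpace ℝ X] [NormedAddCommGroup Y]
    (F : X → Set Y) (x : X) (y : Y) : ℝ≥0∞ :=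
  Filter.liminf (fun x' : X => EMetric.infEdist y (F x')) (𝓝 x)

/-- The nonlocal slope `|Γf|(x)`: equal to `+∞` if `f x = +∞`, to `0` if `x` is a local
minimum of `f`, and otherwise to `sup_{z ≠ x} [f(x) − f(z)]₊ / d(x,z)` (the positive part
being realized by the truncated subtraction of `ℝ≥0∞`). -/
def nonlocalSlope {X : Type*} [PseudoEMetricSpace X] (f : X → ℝ≥0∞) (x : X) : ℝ≥0∞ :=
  if f x = ⊤ then ⊤
  else if ∀ᶠ z in 𝓝 x, f x ≤ f z then 0
  else ⨆ z : {z : X // z ≠ x}, (f x - f (z : X)) / edist x (z : X)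

/-- The local slope `|∇f|(x)`: equal to `+∞` if `f x = +∞`, to `0` if `x` is a local
minimum of `f`, and otherwise to `limsup_{z → x, z ≠ x} (f(x) − f(z)) / d(x,z)`. -/
def localSlope {X : Type*} [PseudoEMetricSpace X] (f : X → ℝ≥0∞) (x : X) : ℝ≥0∞ :=
  if f x = ⊤ then ⊤
  else if ∀ᶠ z in 𝓝 x, f x ≤ f z then 0
  else Filter.limsup (fun z : X => (f x - f z) / edist x z) (𝓝[≠] x)

/-- The filter of directional convergence `(x,y) →_{(u,v)} (xbar,ybar)`:
convergence to `(xbar,ybar)` together with eventual membership of `(x,y) − (xbar,ybar)`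
in every conic neighborhood `cone B((u,v), δ)`, `δ > 0`, of the direction `(u,v)`. -/
def dirFilter {X Y : Type*} [NormedAddCommGroup X] [NormedSpace ℝ X]
    [NormedAddCommGroup Y] [NormedSpace ℝ Y] (xbar : X) (ybar : Y) (u : X) (v : Y) :
    Filter (X × Y) :=
  𝓝 (xbar, ybar) ⊓
    ⨅ (δ : ℝ) (_ : 0 < δ), 𝓟 {p : X × Y | (p.1 - xbar, p.2 - ybar) ∈ coneBall2 u v δ}

/-- The filter encoding the constrained directional convergence
`(x,y) →_{(u,v)} (xbar,ybar)`, `φ(x,y) > 0`, `φ(x,y)^γ/‖(x,y) − (xbar,ybar)‖ → 0`. -/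
def dirRegFilter {X Y : Type*} [NormedAddCommGroup X] [NormedSpace ℝ X]
    [NormedAddCommGroup Y] [NormedSpace ℝ Y]
    (F : X → Set Y) (xbar : X) (ybar : Y) (u : X) (v : Y) (γ : ℝ) : Filter (X × Y) :=
  dirFilter xbar ybar u v ⊓ 𝓟 {p : X × Y | 0 < lscEnv F p.1 p.2} ⊓
    ⨅ (η : ℝ) (_ : 0 < η),
      𝓟 {p : X × Y |
        lscEnv F p.1 p.2 ^ γ < ENNReal.ofReal (η * (‖p.1 - xbar‖ + ‖p.2 - ybar‖))}

section Ekeland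

variable {X : Type*} [MetricSpace X]

/-- A weak form of Ekeland's variational principle. -/
theorem LowerSemicontinuous.exists_forall_le_add_edist [CompleteSpace X] {f : X → ℝ≥0∞}
    (hf : LowerSemicontinuous f) {x₀ : X} (hx₀ : f x₀ ≠ ⊤) {c : ℝ≥0} (hc : c ≠ 0) :
    ∃ a, f a + c * edist x₀ a ≤ f x₀ ∧ ∀ z, f a ≤ f z + c * edist a z := by
  let S : X → Set X := fun x => {z | f z + c * edist x z ≤ f x}
  have hself : ∀ x, x ∈ S x := fun x => by simp [S]
  have hle : ∀ {x z}, z ∈ S x → f z ≤ f x := fun h => le_self_add.trans h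
  have htrans : ∀ {x y z}, y ∈ S x → z ∈ S y → z ∈ S x := by
    intro x y z hy hz
    calc f z + c * edist x z ≤ f z + c * (edist x y + edist y z) := by
          gcongr; exact edist_triangle _ _ _
      _ = (f z + c * edist y z) + c * edist x y := by ring
      _ ≤ f y + c * edist x y := by gcongr; exact hz
      _ ≤ f x := hy
  have hclosed : ∀ x, IsClosed (S x) := by
    intro x
    have hcont : Continuous fun z => (c : ℝ≥0∞) * edist x z :=
      ENNReal.continuous_const_mul ENNReal.coe_ne_top |>.comp (by fun_prop)
    exact (hf.add hcont.lowerSemicontinuous).isClosed_preimage (f x)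
  have hstep : ∀ (n : ℕ) (x : {x // f x ≠ ⊤}), ∃ y : {x // f x ≠ ⊤}, y.1 ∈ S x ∧
      ∀ z ∈ S x, f y ≤ f z + c * (1 / 2 ^ n) := by
    intro n x
    have hfin : (⨅ z ∈ S x.1, f z) ≠ ⊤ :=
      ((iInf₂_le x.1 (hself _)).trans_lt x.2.lt_top).ne
    have hpos : (c : ℝ≥0∞) * (1 / 2 ^ n) ≠ 0 := by simp [hc]
    have hlt := ENNReal.lt_add_right hfin hpos
    obtain ⟨y, hyS, hy⟩ : ∃ y ∈ S x.1, f y < (⨅ z ∈ S x.1, f z) + c * (1 / 2 ^ n) := by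
      simpa only [iInf_lt_iff, exists_prop] using hlt
    refine ⟨⟨y, ((hle hyS).trans_lt x.2.lt_top).ne⟩, hyS, fun z hz => hy.le.trans ?_⟩
    gcongr
    exact iInf₂_le z hz
  choose g hgS hg using hstep
  let s : ℕ → {x // f x ≠ ⊤} := fun n => Nat.rec ⟨x₀, hx₀⟩ (fun n x => g n x) n
  have hsucc : ∀ n, s (n + 1) = g n (s n) := fun n => rfl
  have hmem : ∀ n k, (s (n + k)).1 ∈ S (s n).1 := by
    intro n k
    induction k with
    | zero => exact hself _
    | succ k ih => exact htrans ih (by rw [← add_assoc, hsucc]; exact hgS _ _)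
  have hbound : ∀ n, ∀ z ∈ S (s (n + 1)).1, f (s (n + 1)) ≤ f z + c * (1 / 2 ^ n) := by
    intro n z hz
    rw [hsucc] at hz ⊢
    exact hg n _ z (htrans (hgS _ _) hz)
  have hdist : ∀ n, edist (s (n + 1)).1 (s (n + 1 + 1)).1 ≤ 1 / 2 ^ n := by
    intro n
    have h1 : f (s (n + 2)) + c * edist (s (n + 1)).1 (s (n + 2)).1 ≤ f (s (n + 1)) :=
      hmem (n + 1) 1
    have h2 := ENNReal.le_of_add_le_add_left (s (n + 2)).2
      (h1.trans (hbound n _ (hmem (n + 1) 1)))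
    exact (ENNReal.mul_le_mul_iff_right (by simpa using hc) ENNReal.coe_ne_top).1 h2
  have hcauchy : CauchySeq fun n => (s (n + 1)).1 :=
    cauchySeq_of_edist_le_geometric_two 1 ENNReal.one_ne_top hdist
  obtain ⟨a, ha⟩ := cauchySeq_tendsto_of_complete hcauchy
  have haS : ∀ n, a ∈ S (s n).1 := fun n =>
    (hclosed _).mem_of_tendsto ha <| by
      filter_upwards [eventually_ge_atTop n] with m hm
      obtain ⟨k, hk⟩ := Nat.exists_eq_add_of_le (hm.trans m.le_succ)
      simpa only [← hk] using hmem n k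
  refine ⟨a, haS 0, fun z => ?_⟩
  by_contra! hz
  have hzS : z ∈ S a := hz.le
  have hlim : Tendsto (fun n : ℕ => f z + c * (1 / 2 ^ n)) atTop (𝓝 (f z)) := by
    have : Tendsto (fun n : ℕ => (1 / 2 : ℝ≥0∞) ^ n) atTop (𝓝 0) :=
      ENNReal.tendsto_pow_atTop_nhds_zero_of_lt_one (by simp)
    have := (ENNReal.Tendsto.const_mul this (Or.inr (ENNReal.coe_ne_top (r := c)))).const_add (f z)
    simpa [ENNReal.inv_pow] using this
  have hfa : f a ≤ f z := ge_of_tendsto' hlim fun n =>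
    (hle (haS (n + 1))).trans (hbound n z (htrans (haS (n + 1)) hzS))
  exact (hfa.trans le_self_add).not_gt hz

end Ekeland

section NonlocalSlope

variable {X : Type*} [MetricSpace X] {f : X → ℝ≥0∞} {x : X} {C : ℝ≥0∞}

theorem le_nonlocalSlope_of_edist_le {z : X}
    (hC : C ≠ 0) (hC' : C ≠ ⊤) (hfx : 0 < f x)
    (hmin : ¬ ∀ᶠ z in 𝓝 x, f x ≤ f z) (hfz : f z = 0) (hxz : edist x z ≤ C * f x) :
    C⁻¹ ≤ nonlocalSlope f x := by
  rw [nonlocalSlope]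
  split_ifs with htop
  · exact le_top
  have hne : z ≠ x := by rintro rfl; exact hfx.ne' hfz
  refine le_trans ?_ (le_iSup _ (⟨z, hne⟩ : {z : X // z ≠ x}))
  rw [hfz, tsub_zero, ENNReal.le_div_iff_mul_le (Or.inl (by simpa using hne.symm))
    (Or.inl (edist_ne_top _ _))]
  calc C⁻¹ * edist x z ≤ C⁻¹ * (C * f x) := by gcongr
    _ = f x := by rw [← mul_assoc, ENNReal.inv_mul_cancel hC hC', one_mul]

theorem nonlocalSlope_le_of_forall_le_add (htop : f x ≠ ⊤)
    (h : ∀ z, f x ≤ f z + C * edist x z) : nonlocalSlope f x ≤ C := by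
  rw [nonlocalSlope, if_neg htop]
  split_ifs
  · exact zero_le
  · exact iSup_le fun z => ENNReal.div_le_of_le_mul (tsub_le_iff_left.2 (h z))

end NonlocalSlope

section Envelope

variable {X Y : Type*} [NormedAddCommGroup X] [NormedSpace ℝ X] [NormedAddCommGroup Y]
  {F : X → Set Y} {x : X} {y : Y}

theorem lscEnv_le_infEDist : lscEnv F x y ≤ infEDist y (F x) :=
  le_of_forall_lt fun _ hc => (eventually_lt_of_lt_liminf hc).self_of_nhds

theorem lscEnv_eq_zero_of_mem (h : y ∈ F x) : lscEnv F x y = 0 :=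
  le_antisymm (lscEnv_le_infEDist.trans (infEDist_zero_of_mem h).le) zero_le

theorem lowerSemicontinuous_lscEnv (F : X → Set Y) (y : Y) :
    LowerSemicontinuous fun x => lscEnv F x y := by
  intro x c hc
  obtain ⟨b, hcb, hb⟩ := exists_between hc
  filter_upwards [(eventually_lt_of_lt_liminf hb).eventually_nhds] with z hz
  exact hcb.trans_le (le_liminf_of_le (h := hz.mono fun _ h => h.le))

theorem exists_near_of_lscEnv_lt {b : ℝ≥0∞} (h : lscEnv F x y < b) {s : ℝ} (hs : 0 < s) :
    ∃ x', ‖x' - x‖ < s ∧ ∃ w ∈ F x', edist y w < b := by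
  obtain ⟨x', h1, h2⟩ := ((frequently_lt_of_liminf_lt (h := h)).and_eventually
    (ball_mem_nhds x hs)).exists
  exact ⟨x', by simpa [dist_eq_norm] using h2, infEDist_lt_iff.1 h1⟩

theorem mem_of_lscEnv_eq_zero (hF : IsClosed {p : X × Y | p.2 ∈ F p.1})
    (h : lscEnv F x y = 0) : y ∈ F x := by
  suffices (x, y) ∈ closure {p : X × Y | p.2 ∈ F p.1} by rwa [hF.closure_eq] at this
  refine Metric.mem_closure_iff.2 fun s hs => ?_
  obtain ⟨x', hx', w, hw, hyw⟩ := exists_near_of_lscEnv_lt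
    (h.trans_lt (ENNReal.ofReal_pos.2 hs)) hs
  refine ⟨(x', w), hw, ?_⟩
  rw [Prod.dist_eq, max_lt_iff]
  refine ⟨by rwa [dist_comm, dist_eq_norm], ?_⟩
  rwa [edist_dist, ENNReal.ofReal_lt_ofReal_iff hs] at hyw

/-- Under a Hölder-type error bound near `x`, the inclusion `y ∈ F z` has a solution `z` whose
distance to `x` is controlled by `φ(x, y) ^ γ`. -/
theorem exists_mem_edist_le {γ τ M ρ : ℝ} (hγ0 : 0 < γ) (hγ1 : γ ≤ 1) (hτ : 0 < τ) (hρ : 0 < ρ)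
    (hpos : 0 < lscEnv F x y) (hlt : lscEnv F x y < ENNReal.ofReal M)
    (hreg : ∀ x', ‖x' - x‖ < ρ → infEDist y (F x') ≤ ENNReal.ofReal M →
      infEDist x' {z | y ∈ F z} ≤ ENNReal.ofReal τ * infEDist y (F x') ^ γ) :
    ∃ z, y ∈ F z ∧ edist x z ≤ ENNReal.ofReal (4 * τ) * lscEnv F x y ^ γ := by
  have htop : lscEnv F x y ^ γ ≠ ⊤ := ENNReal.rpow_ne_top_of_nonneg hγ0.le hlt.ne_top
  have hpos' : 0 < lscEnv F x y ^ γ := ENNReal.rpow_pos hpos hlt.ne_top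
  have hτ' : 0 < ENNReal.ofReal τ := ENNReal.ofReal_pos.2 hτ
  set t := ENNReal.ofReal τ * lscEnv F x y ^ γ with ht
  have ht0 : 0 < t := ENNReal.mul_pos hτ'.ne' hpos'.ne'
  have htt : t ≠ ⊤ := ENNReal.mul_ne_top ENNReal.ofReal_ne_top htop
  have h2 : lscEnv F x y < 2 * lscEnv F x y := by
    rw [two_mul]; exact ENNReal.lt_add_right hlt.ne_top hpos.ne'
  obtain ⟨x', hx', w, hw, hyw⟩ := exists_near_of_lscEnv_lt (lt_min hlt h2)
    (lt_min hρ (ENNReal.toReal_pos ht0.ne' htt))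
  have hd := (infEDist_le_edist_of_mem hw).trans hyw.le
  have hsol : infEDist x' {z | y ∈ F z} < 3 * t := by
    calc _ ≤ ENNReal.ofReal τ * infEDist y (F x') ^ γ :=
          hreg x' (hx'.trans_le (min_le_left _ _)) (hd.trans (min_le_left _ _))
      _ ≤ ENNReal.ofReal τ * (2 * lscEnv F x y) ^ γ := by
          gcongr; exact hd.trans (min_le_right _ _)
      _ ≤ ENNReal.ofReal τ * (2 * lscEnv F x y ^ γ) := by
          rw [ENNReal.mul_rpow_of_nonneg _ _ hγ0.le]
          gcongr
          simpa using ENNReal.rpow_le_rpow_of_exponent_le (x := 2) (by norm_num) hγ1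
      _ = 2 * t := by rw [ht]; ring
      _ < 2 * t + t := ENNReal.lt_add_right (ENNReal.mul_ne_top (by simp) htt) ht0.ne'
      _ = 3 * t := by ring
  obtain ⟨z, hz, hxz⟩ := infEDist_lt_iff.1 hsol
  refine ⟨z, hz, (edist_triangle x x' z).trans ?_⟩
  have hxx' : edist x x' ≤ t := by
    rw [edist_comm, edist_dist, dist_eq_norm]
    exact ENNReal.ofReal_le_of_le_toReal (hx'.le.trans (min_le_right _ _))
  calc _ ≤ t + 3 * t := by gcongr
    _ = ENNReal.ofReal (4 * τ) * lscEnv F x y ^ γ := by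
      rw [ENNReal.ofReal_mul (by norm_num), ht]; norm_num; ring

end Envelope

section Directional

variable {X Y : Type*} [NormedAddCommGroup X] [NormedSpace ℝ X]
  [NormedAddCommGroup Y] [NormedSpace ℝ Y]

theorem coneBall2_mono {u : X} {v : Y} {ε ε' : ℝ} (h : ε ≤ ε') :
    coneBall2 u v ε ⊆ coneBall2 u v ε' := by
  rintro p ⟨l, hl, w, z, hwz, hp⟩
  exact ⟨l, hl, w, z, hwz.trans_le h, hp⟩

/-- A relatively small perturbation of a nonzero element of a cone lies in a larger cone. -/
theorem exists_perturb_mem_coneBall2 (u : X) (v : Y) {ε : ℝ} (hε : 0 < ε) :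
    ∃ κ > (0 : ℝ), ∀ (a a' : X) (b b' : Y), (a, b) ∈ coneBall2 u v (ε / 2) →
      0 < ‖a‖ + ‖b‖ → ‖a' - a‖ + ‖b' - b‖ ≤ κ * (‖a‖ + ‖b‖) → (a', b') ∈ coneBall2 u v ε := by
  have hU : 0 < ‖u‖ + ‖v‖ + ε / 2 := by positivity
  refine ⟨ε / 2 / (‖u‖ + ‖v‖ + ε / 2), by positivity, ?_⟩
  rintro a a' b b' ⟨l, hl, w, z, hwz, hab⟩ hpos hle
  obtain ⟨rfl, rfl⟩ := Prod.mk.inj hab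
  rcases hl.eq_or_lt with rfl | hl
  · simp at hpos
  refine ⟨l, hl.le, l⁻¹ • a', l⁻¹ • b', ?_, by simp [hl.ne']⟩
  have h1 : ‖l⁻¹ • a' - w‖ = l⁻¹ * ‖a' - l • w‖ := by
    rw [← norm_smul_of_nonneg (inv_pos.2 hl).le, smul_sub, inv_smul_smul₀ hl.ne']
  have h2 : ‖l⁻¹ • b' - z‖ = l⁻¹ * ‖b' - l • z‖ := by
    rw [← norm_smul_of_nonneg (inv_pos.2 hl).le, smul_sub, inv_smul_smul₀ hl.ne']
  have h3 : ‖l⁻¹ • a' - w‖ + ‖l⁻¹ • b' - z‖ ≤ ε / 2 := by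
    rw [norm_smul, norm_smul, Real.norm_of_nonneg hl.le] at hle
    have hw := norm_sub_norm_le w u
    have hz := norm_sub_norm_le z v
    calc _ = l⁻¹ * (‖a' - l • w‖ + ‖b' - l • z‖) := by rw [h1, h2]; ring
      _ ≤ l⁻¹ * (ε / 2 / (‖u‖ + ‖v‖ + ε / 2) * (l * ‖w‖ + l * ‖z‖)) := by gcongr
      _ = ε / 2 / (‖u‖ + ‖v‖ + ε / 2) * (‖w‖ + ‖z‖) := by field_simp
      _ ≤ ε / 2 / (‖u‖ + ‖v‖ + ε / 2) * (‖u‖ + ‖v‖ + ε / 2) := by exact mul_le_mul_of_nonneg_left (by linarith) (by positivity)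
      _ = ε / 2 := by field_simp
  have h4 := norm_sub_le_norm_sub_add_norm_sub (l⁻¹ • a') w u
  have h5 := norm_sub_le_norm_sub_add_norm_sub (l⁻¹ • b') z v
  linarith

theorem eventually_dirRegFilter_iff {F : X → Set Y} {xbar : X} {ybar : Y} {u : X} {v : Y}
    {γ : ℝ} {P : X × Y → Prop} :
    (∀ᶠ p in dirRegFilter F xbar ybar u v γ, P p) ↔
      ∃ δ > (0 : ℝ), ∃ ε > (0 : ℝ), ∃ η > (0 : ℝ), ∀ x y, ‖x - xbar‖ + ‖y - ybar‖ < δ →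
        (x - xbar, y - ybar) ∈ coneBall2 u v ε → 0 < lscEnv F x y →
        lscEnv F x y ^ γ < ENNReal.ofReal (η * (‖x - xbar‖ + ‖y - ybar‖)) → P (x, y) := by
  have hcone : (⨅ (δ : ℝ) (_ : 0 < δ),
      𝓟 {p : X × Y | (p.1 - xbar, p.2 - ybar) ∈ coneBall2 u v δ}).HasBasis (0 < ·)
      fun δ => {p : X × Y | (p.1 - xbar, p.2 - ybar) ∈ coneBall2 u v δ} := by
    refine hasBasis_biInf_principal (S := Ioi (0 : ℝ)) ?_ ⟨1, mem_Ioi.2 one_pos⟩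
    intro a ha b hb
    exact ⟨min a b, lt_min (mem_Ioi.1 ha) hb, fun p hp => coneBall2_mono (min_le_left a b) hp,
      fun p hp => coneBall2_mono (min_le_right a b) hp⟩
  have hval : (⨅ (η : ℝ) (_ : 0 < η), 𝓟 {p : X × Y | lscEnv F p.1 p.2 ^ γ <
      ENNReal.ofReal (η * (‖p.1 - xbar‖ + ‖p.2 - ybar‖))}).HasBasis (0 < ·)
      fun η => {p : X × Y | lscEnv F p.1 p.2 ^ γ <
        ENNReal.ofReal (η * (‖p.1 - xbar‖ + ‖p.2 - ybar‖))} := by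
    refine hasBasis_biInf_principal (S := Ioi (0 : ℝ)) ?_ ⟨1, mem_Ioi.2 one_pos⟩
    intro a ha b hb
    have hanti : ∀ {η η' : ℝ}, η ≤ η' → {p : X × Y | lscEnv F p.1 p.2 ^ γ <
        ENNReal.ofReal (η * (‖p.1 - xbar‖ + ‖p.2 - ybar‖))} ⊆ {p : X × Y | lscEnv F p.1 p.2 ^ γ <
        ENNReal.ofReal (η' * (‖p.1 - xbar‖ + ‖p.2 - ybar‖))} := fun h p hp =>
      lt_of_lt_of_le (b := ENNReal.ofReal (_ * _)) hp (by gcongr)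
    exact ⟨min a b, lt_min (mem_Ioi.1 ha) hb, hanti (min_le_left a b), hanti (min_le_right a b)⟩
  have hnhds : (𝓝 (xbar, ybar)).HasBasis (0 < ·)
      fun δ : ℝ => {p : X × Y | ‖p.1 - xbar‖ + ‖p.2 - ybar‖ < δ} := by
    refine Metric.nhds_basis_ball.to_hasBasis (fun s hs => ⟨s, hs, fun p hp => ?_⟩)
      fun s hs => ⟨s / 2, half_pos hs, fun p hp => ?_⟩
    · simp only [mem_setOf_eq] at hp
      rw [mem_ball, Prod.dist_eq, max_lt_iff, dist_eq_norm, dist_eq_norm]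
      constructor <;> linarith [norm_nonneg (p.1 - xbar), norm_nonneg (p.2 - ybar)]
    · rw [mem_ball, Prod.dist_eq, max_lt_iff, dist_eq_norm, dist_eq_norm] at hp
      simp only [mem_setOf_eq]
      linarith [hp.1, hp.2]
  have hbasis := ((hnhds.inf hcone).inf_principal {p | 0 < lscEnv F p.1 p.2}).inf hval
  rw [dirRegFilter, dirFilter, hbasis.eventually_iff]
  constructor
  · rintro ⟨⟨⟨δ, ε⟩, η⟩, ⟨⟨hδ, hε⟩, hη⟩, h⟩
    exact ⟨δ, hδ, ε, hε, η, hη, fun x y h1 h2 h3 h4 => h ⟨⟨⟨h1, h2⟩, h3⟩, h4⟩⟩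
  · rintro ⟨δ, hδ, ε, hε, η, hη, h⟩
    exact ⟨⟨⟨δ, ε⟩, η⟩, ⟨⟨hδ, hε⟩, hη⟩,
      fun {p} hp => h p.1 p.2 hp.1.1.1 hp.1.1.2 hp.1.2 hp.2⟩

end Directional

section Regularity

variable {X Y : Type*} [NormedAddCommGroup X] [NormedSpace ℝ X]
  [NormedAddCommGroup Y] [NormedSpace ℝ Y]
  {F : X → Set Y} {xbar x : X} {ybar y : Y} {u : X} {v : Y} {γ τ M ρ : ℝ}

/-- A Hölder-type error bound for `F` at all points of a neighborhood of `(x, y)` excludes that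
`x` is a local minimum of `φ(·, y)`: moving `y` towards a nearly closest point of `F x` and solving
the inclusion there decreases `φ(·, y)`. -/
theorem not_eventually_lscEnv_le (hγ : 0 < γ) (hM : 0 < M) (hρ : 0 < ρ)
    (hpos : 0 < lscEnv F x y) (hlt : lscEnv F x y < ENNReal.ofReal M)
    (hreg : ∀ x' y', ‖x' - x‖ < ρ → ‖y' - y‖ ≤ M →
      infEDist y' (F x') ≤ ENNReal.ofReal M →
      infEDist x' {z | y' ∈ F z} ≤ ENNReal.ofReal τ * infEDist y' (F x') ^ γ) :
    ¬ ∀ᶠ z in 𝓝 x, lscEnv F x y ≤ lscEnv F z y := by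
  intro hmin
  obtain ⟨r, hr, hmin⟩ := Metric.eventually_nhds_iff.1 hmin
  obtain ⟨m, hm⟩ : ∃ m : ℝ, m = (lscEnv F x y).toReal := ⟨_, rfl⟩
  have hφ : lscEnv F x y = ENNReal.ofReal m := by rw [hm, ENNReal.ofReal_toReal hlt.ne_top]
  have hm0 : 0 < m := by rwa [hφ, ENNReal.ofReal_pos] at hpos
  have hmM : m < M := by rwa [hφ, ENNReal.ofReal_lt_ofReal_iff hM] at hlt
  obtain ⟨θ, hθ, hθ0, hθ1⟩ : ∃ θ : ℝ, τ * (θ * M) ^ γ < r / 2 ∧ 0 < θ ∧ θ < 1 := by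
    have hcont : ContinuousAt (fun θ : ℝ => τ * (θ * M) ^ γ) 0 :=
      (((continuous_id.mul continuous_const).rpow_const fun _ => Or.inr hγ.le).const_mul
        τ).continuousAt
    have h0 : τ * (0 * M) ^ γ < r / 2 := by simp [Real.zero_rpow hγ.ne', hr]
    have h : ∀ᶠ θ in 𝓝[>] (0 : ℝ), τ * (θ * M) ^ γ < r / 2 :=
      (hcont.eventually_lt continuousAt_const h0).filter_mono nhdsWithin_le_nhds
    exact (h.and (Ioo_mem_nhdsGT one_pos)).exists
  obtain ⟨s, hs0, hsθ, hsM⟩ : ∃ s : ℝ, 0 < s ∧ s ≤ θ * m ∧ m + s ≤ M :=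
    ⟨min (θ * m) (M - m), lt_min (by positivity) (by linarith), min_le_left _ _,
      by linarith [min_le_right (θ * m) (M - m)]⟩
  obtain ⟨x', hx', w, hw, hyw⟩ := exists_near_of_lscEnv_lt (b := ENNReal.ofReal (m + s))
    (hφ.trans_lt ((ENNReal.ofReal_lt_ofReal_iff (by linarith)).2 (by linarith)))
    (lt_min hρ (half_pos hr))
  rw [edist_dist, ENNReal.ofReal_lt_ofReal_iff (by linarith), dist_eq_norm] at hyw
  have hyw0 := norm_nonneg (y - w)
  set y' := w + θ • (y - w) with hy'
  have hy'w : ‖y' - w‖ = θ * ‖y - w‖ := by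
    rw [hy', add_sub_cancel_left, norm_smul_of_nonneg hθ0.le]
  have hyy' : ‖y - y'‖ = (1 - θ) * ‖y - w‖ := by
    rw [← norm_smul_of_nonneg (by linarith : 0 ≤ 1 - θ), hy']
    congr 1
    module
  have hdist : infEDist y' (F x') ≤ ENNReal.ofReal (θ * M) := by
    refine (infEDist_le_edist_of_mem hw).trans ?_
    rw [edist_dist, dist_eq_norm, hy'w]
    gcongr
    linarith
  have hsol : infEDist x' {z | y' ∈ F z} < ENNReal.ofReal (r / 2) := by
    refine (hreg x' y' (hx'.trans_le (min_le_left _ _)) ?_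
      (hdist.trans (ENNReal.ofReal_le_ofReal (by nlinarith)))).trans_lt ?_
    · rw [norm_sub_rev, hyy']
      nlinarith
    · calc _ ≤ ENNReal.ofReal τ * ENNReal.ofReal (θ * M) ^ γ := by gcongr
        _ = ENNReal.ofReal (τ * (θ * M) ^ γ) := by
          rw [ENNReal.ofReal_rpow_of_pos (by positivity), ENNReal.ofReal_mul' (by positivity)]
        _ < ENNReal.ofReal (r / 2) := (ENNReal.ofReal_lt_ofReal_iff (half_pos hr)).2 hθ
  obtain ⟨z, hz, hxz⟩ := infEDist_lt_iff.1 hsol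
  rw [edist_dist, ENNReal.ofReal_lt_ofReal_iff (half_pos hr)] at hxz
  have hzx : dist z x < r := by
    have h1 : dist x' x < r / 2 := by
      rw [dist_eq_norm]; exact hx'.trans_le (min_le_right _ _)
    linarith [dist_triangle z x' x, dist_comm z x']
  have hle : ENNReal.ofReal m ≤ ENNReal.ofReal ((1 - θ) * ‖y - w‖) := by
    rw [← hφ, ← hyy', ← dist_eq_norm, ← edist_dist]
    exact (hmin hzx).trans (lscEnv_le_infEDist.trans (infEDist_le_edist_of_mem hz))
  rw [ENNReal.ofReal_le_ofReal_iff (by nlinarith)] at hle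
  nlinarith [mul_pos hθ0 (mul_pos hθ0 hm0),
    mul_le_mul_of_nonneg_left (hyw.le.trans (add_le_add_right hsθ m)) (by linarith : 0 ≤ 1 - θ)]

end Regularity

section Characterization

variable {X Y : Type*} [NormedAddCommGroup X] [NormedSpace ℝ X]
  [NormedAddCommGroup Y] [NormedSpace ℝ Y]
  {F : X → Set Y} {xbar : X} {ybar : Y} {u : X} {v : Y} {γ : ℝ}

theorem DirHolderRegular.liminf_nonlocalSlope_pos {τ : ℝ} (hτ : 0 < τ)
    (h : DirHolderRegular F xbar ybar u v γ τ) (hγ0 : 0 < γ) (hγ1 : γ ≤ 1) :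
    0 < liminf (fun p : X × Y => nonlocalSlope (fun x : X => lscEnv F x p.2 ^ γ) p.1)
      (dirRegFilter F xbar ybar u v γ) := by
  obtain ⟨δ, hδ, ε, hε, η, hη, hreg⟩ := h
  obtain ⟨κ, hκ, hcone⟩ := exists_perturb_mem_coneBall2 u v hε
  refine lt_of_lt_of_le (ENNReal.inv_pos.2 (ENNReal.ofReal_ne_top (r := 4 * τ)))
    (le_liminf_of_le (h := eventually_dirRegFilter_iff.2 ?_))
  obtain ⟨η', hη'0, hη'1, hη'η, hη'κ, hη'2⟩ : ∃ η' : ℝ, 0 < η' ∧ η' ≤ 1 ∧ η' ≤ η ^ γ / 2 ∧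
      η' ≤ κ / 2 ∧ η' ≤ 1 / 4 :=
    ⟨min (min 1 (η ^ γ / 2)) (min (κ / 2) (1 / 4)), by positivity,
      (min_le_left _ _).trans (min_le_left _ _), (min_le_left _ _).trans (min_le_right _ _),
      (min_le_right _ _).trans (min_le_left _ _), (min_le_right _ _).trans (min_le_right _ _)⟩
  refine ⟨min (δ / 2) 1, by positivity, ε / 2, half_pos hε, η', hη'0, ?_⟩
  intro x y hr hxy hpos hlt
  set r := ‖x - xbar‖ + ‖y - ybar‖ with hr_def
  have hr1 : r < 1 := hr.trans_le (min_le_right _ _)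
  have hrδ : r < δ / 2 := hr.trans_le (min_le_left _ _)
  have hηr : 0 < η' * r := ENNReal.ofReal_pos.1 (zero_le.trans_lt hlt)
  have hr0 : 0 < r := pos_of_mul_pos_right hηr hη'0.le
  set M := (η' * r) ^ γ⁻¹ with hM_def
  have hM0 : 0 < M := Real.rpow_pos_of_pos hηr _
  have hMle : M ≤ η' * r :=
    Real.rpow_le_self_of_le_one hηr.le (mul_le_one₀ hη'1 hr0.le hr1.le) ((one_le_inv₀ hγ0).2 hγ1)
  have hφM : lscEnv F x y < ENNReal.ofReal M := by
    rw [hM_def, ← ENNReal.ofReal_rpow_of_pos hηr]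
    exact (ENNReal.lt_rpow_inv_iff hγ0).2 hlt
  have hreg' : ∀ x' y', ‖x' - x‖ < η' * r → ‖y' - y‖ ≤ M →
      infEDist y' (F x') ≤ ENNReal.ofReal M →
      infEDist x' {z | y' ∈ F z} ≤ ENNReal.ofReal τ * infEDist y' (F x') ^ γ := by
    intro x' y' hx' hy' hd
    have hx1 := norm_sub_le_norm_sub_add_norm_sub x' x xbar
    have hx2 := norm_sub_le_norm_sub_add_norm_sub x x' xbar
    have hy1 := norm_sub_le_norm_sub_add_norm_sub y' y ybar
    have hy2 := norm_sub_le_norm_sub_add_norm_sub y y' ybar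
    rw [norm_sub_rev x x'] at hx2
    rw [norm_sub_rev y y'] at hy2
    have h4 : η' * r ≤ 1 / 4 * r := by gcongr
    have hκr : η' * r ≤ κ / 2 * r := by gcongr
    refine hreg x' y' (by linarith) (hcone _ _ _ _ hxy hr0 ?_) (hd.trans ?_)
    · rw [sub_sub_sub_cancel_right, sub_sub_sub_cancel_right]
      linarith
    · gcongr
      rw [one_div]
      calc M ≤ (η ^ γ * (r / 2)) ^ γ⁻¹ := by
            refine Real.rpow_le_rpow hηr.le ?_ (by positivity)
            calc η' * r ≤ η ^ γ / 2 * r := by gcongr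
              _ = η ^ γ * (r / 2) := by ring
        _ = η * (r / 2) ^ γ⁻¹ := by
            rw [Real.mul_rpow (by positivity) (by positivity),
              Real.rpow_rpow_inv hη.le hγ0.ne']
        _ ≤ η * (‖x' - xbar‖ + ‖y' - ybar‖) ^ γ⁻¹ := by
            refine mul_le_mul_of_nonneg_left ?_ hη.le
            exact Real.rpow_le_rpow (by positivity) (by linarith) (by positivity)
  obtain ⟨z, hz, hxz⟩ := exists_mem_edist_le hγ0 hγ1 hτ hηr hpos hφM fun x' hx' hd =>
    hreg' x' y hx' (by simpa using hM0.le) hd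
  refine le_nonlocalSlope_of_edist_le (z := z) (ENNReal.ofReal_pos.2 (by positivity)).ne'
    ENNReal.ofReal_ne_top (ENNReal.rpow_pos hpos hφM.ne_top) ?_ ?_ hxz
  · simp only [ENNReal.rpow_le_rpow_iff hγ0]
    exact not_eventually_lscEnv_le hγ0 hM0 hηr hpos hφM hreg'
  · simp [lscEnv_eq_zero_of_mem hz, hγ0]

theorem exists_dirHolderRegular_of_liminf_nonlocalSlope_pos [CompleteSpace X]
    (hF : IsClosed {p : X × Y | p.2 ∈ F p.1}) (hγ0 : 0 < γ)
    (h : 0 < liminf (fun p : X × Y => nonlocalSlope (fun x : X => lscEnv F x p.2 ^ γ) p.1)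
      (dirRegFilter F xbar ybar u v γ)) :
    ∃ τ > (0 : ℝ), DirHolderRegular F xbar ybar u v γ τ := by
  obtain ⟨c, hc0, hc⟩ := ENNReal.lt_iff_exists_nnreal_btwn.1 h
  replace hc0 : 0 < c := by exact_mod_cast hc0
  obtain ⟨δ, hδ, ε, hε, η, hη, hslope⟩ :=
    eventually_dirRegFilter_iff.1 (eventually_lt_of_lt_liminf hc)
  obtain ⟨κ, hκ, hcone⟩ := exists_perturb_mem_coneBall2 u v hε
  obtain ⟨β, hβ0, hβη, hβκ, hβ2⟩ : ∃ β : ℝ, 0 < β ∧ β ≤ η / 4 ∧ β ≤ c * κ ∧ β ≤ c * (1 / 2) :=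
    ⟨min (η / 4) (min (c * κ) (c * (1 / 2))), by positivity, min_le_left _ _,
      (min_le_right _ _).trans (min_le_left _ _), (min_le_right _ _).trans (min_le_right _ _)⟩
  refine ⟨(c : ℝ)⁻¹, by positivity, δ / 2, half_pos hδ, ε / 2, half_pos hε, β ^ γ⁻¹,
    by positivity, ?_⟩
  intro x y hrδ hxy hd
  change infEDist y (F x) ≤ _ at hd
  change infEDist x _ ≤ _ * infEDist y (F x) ^ γ
  set r := ‖x - xbar‖ + ‖y - ybar‖ with hr_def
  have hr_nonneg : 0 ≤ r := by positivity
  rcases eq_or_ne (lscEnv F x y) 0 with h0 | h0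
  · have hmem : y ∈ F x := mem_of_lscEnv_eq_zero hF h0
    exact (infEDist_zero_of_mem (s := {x' | y ∈ F x'}) hmem).trans_le bot_le
  have hfx : infEDist y (F x) ^ γ ≤ ENNReal.ofReal (β * r) := by
    rw [one_div, ← Real.mul_rpow hβ0.le hr_nonneg, ← ENNReal.ofReal_rpow_of_nonneg
      (by positivity) (by positivity)] at hd
    exact (ENNReal.le_rpow_inv_iff hγ0).1 hd
  have hφd : lscEnv F x y ^ γ ≤ infEDist y (F x) ^ γ := by
    gcongr
    exact lscEnv_le_infEDist
  have hr0 : 0 < r := by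
    refine hr_nonneg.lt_of_ne' fun hr => h0 ?_
    simpa [hr, hγ0, hγ0.not_gt] using hφd.trans hfx
  have hlsc : LowerSemicontinuous fun x => lscEnv F x y ^ γ :=
    (ENNReal.continuous_rpow_const (y := γ)).comp_lowerSemicontinuous
      (lowerSemicontinuous_lscEnv F y) (ENNReal.monotone_rpow_of_nonneg hγ0.le)
  obtain ⟨a, hax, ha⟩ := hlsc.exists_forall_le_add_edist
    ((hφd.trans hfx).trans_lt ENNReal.ofReal_lt_top).ne hc0.ne'
  have hfa : lscEnv F a y ^ γ ≤ ENNReal.ofReal (β * r) :=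
    (le_self_add.trans hax).trans (hφd.trans hfx)
  have hdist : c * ‖a - x‖ ≤ β * r := by
    have h1 := (le_add_self.trans hax).trans (hφd.trans hfx)
    rwa [edist_comm, edist_dist, dist_eq_norm, ← ENNReal.ofReal_coe_nnreal,
      ← ENNReal.ofReal_mul c.coe_nonneg, ENNReal.ofReal_le_ofReal_iff (by positivity)] at h1
  have hc0' : (0 : ℝ) < c := hc0
  have haκ : ‖a - x‖ ≤ κ * r := by
    refine le_of_mul_le_mul_left (hdist.trans ?_) hc0'
    calc β * r ≤ c * κ * r := by gcongr
      _ = c * (κ * r) := by ring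
  have ha2 : ‖a - x‖ ≤ 1 / 2 * r := by
    refine le_of_mul_le_mul_left (hdist.trans ?_) hc0'
    calc β * r ≤ c * (1 / 2) * r := by gcongr
      _ = c * (1 / 2 * r) := by ring
  have hx1 := norm_sub_le_norm_sub_add_norm_sub a x xbar
  have hx2 := norm_sub_le_norm_sub_add_norm_sub x a xbar
  rw [norm_sub_rev x a] at hx2
  have hya : y ∈ F a := by
    by_contra hya
    have hpos : 0 < lscEnv F a y :=
      pos_iff_ne_zero.2 fun h0 => hya (mem_of_lscEnv_eq_zero hF h0)
    refine (hslope a y (by linarith) (hcone _ _ _ _ hxy hr0 ?_) hpos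
      (hfa.trans_lt ((ENNReal.ofReal_lt_ofReal_iff_of_nonneg (by positivity)).2 ?_))).not_ge
      (nonlocalSlope_le_of_forall_le_add (hfa.trans_lt ENNReal.ofReal_lt_top).ne ha)
    · simpa using haκ
    · calc β * r ≤ η / 4 * r := by gcongr
        _ < η * (r / 2) := by nlinarith [mul_pos hη hr0]
        _ ≤ η * (‖a - xbar‖ + ‖y - ybar‖) := by gcongr; linarith
  calc infEDist x {z | y ∈ F z} ≤ edist x a := infEDist_le_edist_of_mem hya
    _ = (c : ℝ≥0∞)⁻¹ * (c * edist x a) := by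
      rw [← mul_assoc, ENNReal.inv_mul_cancel (by simpa using hc0.ne') ENNReal.coe_ne_top,
        one_mul]
    _ ≤ (c : ℝ≥0∞)⁻¹ * infEDist y (F x) ^ γ := by
      gcongr
      exact (le_add_self.trans hax).trans hφd
    _ = ENNReal.ofReal (c : ℝ)⁻¹ * infEDist y (F x) ^ γ := by
      rw [ENNReal.ofReal_inv_of_pos hc0', ENNReal.ofReal_coe_nnreal]

end Characterization

/-- Theorem 1 of the paper: `F` is directionally metrically `γ`-regular
at `(xbar,ybar)` in direction `(u,v)` iff the liminf of the nonlocal slopes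
`|Γ φ^γ(·,y)|(x)`, taken as `(x,y) →_{(u,v)} (xbar,ybar)` with `φ(x,y) > 0` and
`φ(x,y)^γ/‖(x,y) − (xbar,ybar)‖ → 0`, is positive. -/
theorem dirHolderRegular_iff_liminf_nonlocalSlope_pos
    {X Y : Type*} [NormedAddCommGroup X] [NormedSpace ℝ X] [CompleteSpace X]
    [NormedAddCommGroup Y] [NormedSpace ℝ Y]
    (F : X → Set Y) (hF : IsClosed {p : X × Y | p.2 ∈ F p.1})
    (xbar : X) (ybar : Y) (hxy : ybar ∈ F xbar) (u : X) (v : Y)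
    (γ : ℝ) (hγ0 : 0 < γ) (hγ1 : γ ≤ 1) :
    (∃ τ > (0:ℝ), DirHolderRegular F xbar ybar u v γ τ) ↔
      0 < Filter.liminf
            (fun p : X × Y => nonlocalSlope (fun x : X => lscEnv F x p.2 ^ γ) p.1)
            (dirRegFilter F xbar ybar u v γ) :=
  ⟨fun ⟨_, hτ, h⟩ => h.liminf_nonlocalSlope_pos hτ hγ0 hγ1,
    exists_dirHolderRegular_of_liminf_nonlocalSlope_pos hF hγ0⟩

end
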